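/- arXiv:1210.0750 — 5 statements merged into one kernel-verified Lean document; each statement's English description precedes it below -/
import Mathlib

section
/- Let Ω > 0. For p ≥ 0 define S_p := {p₀ ∈ ℝ : |p₀² − p²| ≤ Ω²}. Then the Lebesgue measure of S_p tends to 0 as p → ∞; explicitly, for p > Ω the measure equals 2(√(p² + Ω²) − √(p² − Ω²)), which tends to 0 as p → ∞. -/
open MeasureTheory Filter

theorem bandwidth_volume_aux (Ω : ℝ) (hΩ : 0 < Ω) (p : ℝ) (hp : Ω < p) :
    volume {p₀ : ℝ | |p₀ ^ 2 - p ^ 2| ≤ Ω ^ 2} =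
      ENNReal.ofReal (2 * (Real.sqrt (p ^ 2 + Ω ^ 2) - Real.sqrt (p ^ 2 - Ω ^ 2))) := by
  have hpos : 0 < p ^ 2 - Ω ^ 2 := by nlinarith
  have hb : 0 < Real.sqrt (p ^ 2 - Ω ^ 2) := Real.sqrt_pos.mpr hpos
  have hab : Real.sqrt (p ^ 2 - Ω ^ 2) ≤ Real.sqrt (p ^ 2 + Ω ^ 2) :=
    Real.sqrt_le_sqrt (by nlinarith)
  have hb2 : Real.sqrt (p ^ 2 - Ω ^ 2) ^ 2 = p ^ 2 - Ω ^ 2 := Real.sq_sqrt hpos.le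
  have ha2 : Real.sqrt (p ^ 2 + Ω ^ 2) ^ 2 = p ^ 2 + Ω ^ 2 := Real.sq_sqrt (by positivity)
  generalize Real.sqrt (p ^ 2 - Ω ^ 2) = b at *
  generalize Real.sqrt (p ^ 2 + Ω ^ 2) = a at *
  have hset : {p₀ : ℝ | |p₀ ^ 2 - p ^ 2| ≤ Ω ^ 2} = Set.Icc (-a) (-b) ∪ Set.Icc b a := by
    ext x
    simp only [Set.mem_ofPred_eq, Set.mem_union, Set.mem_Icc, abs_le]
    constructor
    · rintro ⟨h1, h2⟩
      have hxa : |x| ≤ a := by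
        by_contra! hc
        nlinarith [abs_nonneg x, sq_abs x]
      have hxb : b ≤ |x| := by
        by_contra! hc
        nlinarith [abs_nonneg x, sq_abs x]
      rcases abs_cases x with ⟨h, _⟩ | ⟨h, _⟩
      · right; constructor <;> linarith
      · left; constructor <;> linarith
    · rintro (⟨h1, h2⟩ | ⟨h1, h2⟩) <;> constructor <;> nlinarith
  rw [hset, measure_union _ measurableSet_Icc, Real.volume_Icc, Real.volume_Icc,
    ← ENNReal.ofReal_add (by linarith) (by linarith)]
  · congr 1; ring
  · rw [Set.disjoint_left]
    rintro x ⟨_, h1⟩ ⟨h2, _⟩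
    linarith

/-- The temporal bandwidth set `S_p = {p₀ : |p₀² − p²| ≤ Ω²}` of a fixed spatial mode
of magnitude `p` has Lebesgue measure tending to `0` as `p → ∞`; explicitly, for `p > Ω`
the measure equals `2(√(p² + Ω²) − √(p² − Ω²))`. -/
theorem temporal_bandwidth_tendsto_zero (Ω : ℝ) (hΩ : 0 < Ω) :
    Tendsto (fun p : ℝ => volume {p₀ : ℝ | |p₀ ^ 2 - p ^ 2| ≤ Ω ^ 2}) atTop (nhds 0) ∧
    ∀ p : ℝ, Ω < p →
      volume {p₀ : ℝ | |p₀ ^ 2 - p ^ 2| ≤ Ω ^ 2} =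
        ENNReal.ofReal (2 * (Real.sqrt (p ^ 2 + Ω ^ 2) - Real.sqrt (p ^ 2 - Ω ^ 2))) := by
  refine ⟨?_, fun p hp => bandwidth_volume_aux Ω hΩ p hp⟩
  have hlim : Tendsto (fun p : ℝ => ENNReal.ofReal (4 * Ω ^ 2 / p)) atTop (nhds 0) := by
    have h := ENNReal.tendsto_ofReal
      ((tendsto_const_nhds (x := 4 * Ω ^ 2)).div_atTop (tendsto_id (α := ℝ) (x := atTop)))
    simpa using h
  refine tendsto_of_tendsto_of_tendsto_of_le_of_le' tendsto_const_nhds hlim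
    (Eventually.of_forall fun _ => zero_le) ?_
  filter_upwards [eventually_gt_atTop Ω] with p hp
  rw [bandwidth_volume_aux Ω hΩ p hp]
  apply ENNReal.ofReal_le_ofReal
  have hp0 : 0 < p := hΩ.trans hp
  have hb := Real.sqrt_nonneg (p ^ 2 - Ω ^ 2)
  have hb2 : Real.sqrt (p ^ 2 - Ω ^ 2) ^ 2 = p ^ 2 - Ω ^ 2 := Real.sq_sqrt (by nlinarith)
  have ha2 : Real.sqrt (p ^ 2 + Ω ^ 2) ^ 2 = p ^ 2 + Ω ^ 2 := Real.sq_sqrt (by positivity)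
  have hab : Real.sqrt (p ^ 2 - Ω ^ 2) ≤ Real.sqrt (p ^ 2 + Ω ^ 2) :=
    Real.sqrt_le_sqrt (by nlinarith)
  have hpa : p ≤ Real.sqrt (p ^ 2 + Ω ^ 2) := Real.le_sqrt_of_sq_le (by nlinarith)
  rw [le_div_iff₀ hp0]
  generalize Real.sqrt (p ^ 2 - Ω ^ 2) = b at *
  generalize Real.sqrt (p ^ 2 + Ω ^ 2) = a at *
  nlinarith [mul_nonneg (sub_nonneg.2 hab) (sub_nonneg.2 hpa), mul_nonneg (sub_nonneg.2 hab) hb]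
end

section
/- Let Ω > 0. For every p ≥ 0, the Lebesgue measure of the set S_p := {p₀ ∈ ℝ : |p₀² − p²| ≤ Ω²} is at most 2√2·Ω. -/
open MeasureTheory

/-- For every spatial momentum magnitude `p ≥ 0`, the temporal bandwidth set
`S_p = {p₀ : |p₀² − p²| ≤ Ω²}` has Lebesgue measure at most `2√2·Ω`. -/
theorem temporal_bandwidth_uniform_bound (Ω : ℝ) (hΩ : 0 < Ω) :
    ∀ p : ℝ, 0 ≤ p →
      volume {p₀ : ℝ | |p₀ ^ 2 - p ^ 2| ≤ Ω ^ 2} ≤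
        ENNReal.ofReal (2 * Real.sqrt 2 * Ω) := by
  intro p hp
  set a := Real.sqrt (p ^ 2 - Ω ^ 2) with ha
  set b := Real.sqrt (p ^ 2 + Ω ^ 2) with hb
  have ha0 : 0 ≤ a := Real.sqrt_nonneg _
  have hs0 : 0 ≤ Real.sqrt 2 := Real.sqrt_nonneg _
  have hs2 : Real.sqrt 2 ^ 2 = 2 := Real.sq_sqrt (by norm_num)
  have ha2 : p ^ 2 - Ω ^ 2 ≤ a ^ 2 := (Real.sqrt_le_left ha0).mp le_rfl
  have hba : b ≤ a + Real.sqrt 2 * Ω := by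
    apply Real.sqrt_le_iff.mpr
    refine ⟨by positivity, ?_⟩
    have h1 : 0 ≤ a * (Real.sqrt 2 * Ω) := by positivity
    have h2 : (Real.sqrt 2 * Ω) ^ 2 = 2 * Ω ^ 2 := by rw [mul_pow, hs2]
    nlinarith
  have hsub : {p₀ : ℝ | |p₀ ^ 2 - p ^ 2| ≤ Ω ^ 2} ⊆ Set.Icc a b ∪ Set.Icc (-b) (-a) := by
    intro x hx
    obtain ⟨h1, h2⟩ := abs_le.mp (show |x ^ 2 - p ^ 2| ≤ Ω ^ 2 from hx)
    have h3 : a ≤ |x| := by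
      apply Real.sqrt_le_iff.mpr
      exact ⟨abs_nonneg x, by rw [sq_abs]; linarith⟩
    have h4 : |x| ≤ b := Real.abs_le_sqrt (by linarith)
    rcases abs_cases x with ⟨h, _⟩ | ⟨h, _⟩
    · left; constructor <;> linarith
    · right; constructor <;> linarith
  calc volume {p₀ : ℝ | |p₀ ^ 2 - p ^ 2| ≤ Ω ^ 2}
      ≤ volume (Set.Icc a b ∪ Set.Icc (-b) (-a)) := measure_mono hsub
    _ ≤ volume (Set.Icc a b) + volume (Set.Icc (-b) (-a)) := measure_union_le _ _
    _ ≤ ENNReal.ofReal (Real.sqrt 2 * Ω) + ENNReal.ofReal (Real.sqrt 2 * Ω) := by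
        rw [Real.volume_Icc, Real.volume_Icc]
        exact add_le_add (ENNReal.ofReal_le_ofReal (by linarith))
          (ENNReal.ofReal_le_ofReal (by linarith))
    _ = ENNReal.ofReal (2 * Real.sqrt 2 * Ω) := by
        rw [← ENNReal.ofReal_add (by positivity) (by positivity)]
        congr 1; ring
end

section
/- Let ω > 0. Then the limit as ε → 0⁺ of ∫_{−∞}^{∞} 1/(x² − ω² + iε) dx exists and equals −iπ/ω, where the integral is the Lebesgue integral of the complex-valued function x ↦ (x² − ω² + iε)⁻¹ over ℝ. -/
open MeasureTheory Filter Complex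

lemma aux_ne (c : ℂ) (hc : 0 < c.re) (x : ℝ) : c + x * I ≠ 0 := by
  intro h
  have := congrArg Complex.re h
  simp at this
  linarith

lemma aux_deriv (c : ℂ) (hc : 0 < c.re) (x : ℝ) :
    HasDerivAt (fun x : ℝ => (2 * I * c)⁻¹ * (Complex.log (c + x * I) - Complex.log (c - x * I)))
      (((x : ℂ) ^ 2 + c ^ 2)⁻¹) x := by
  have hx : HasDerivAt (fun x : ℝ => (x : ℂ) * I) I x := by
    simpa using (Complex.ofRealCLM.hasDerivAt (x := x)).mul_const I
  have h1 := (hx.const_add c).clog_real (Or.inl (by simpa using hc))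
  have h2 := (hx.const_sub c).clog_real (Or.inl (by simpa using hc))
  have h := (h1.sub h2).const_mul ((2 * I * c)⁻¹)
  refine h.congr_deriv ?_
  have n1 := aux_ne c hc x
  have n2 : c - x * I ≠ 0 := by
    have := aux_ne c hc (-x)
    simpa [sub_eq_add_neg] using this
  have n0 : c ≠ 0 := by rintro rfl; simp at hc
  have e : (x : ℂ) ^ 2 + c ^ 2 = (c + x * I) * (c - x * I) := by
    linear_combination (x : ℂ) ^ 2 * I_sq
  rw [e]
  have e3 : (c + x * I) + (c - x * I) = 2 * c := by ring
  have hI := I_ne_zero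
  generalize c + x * I = a at *
  generalize c - x * I = b at *
  field_simp
  linear_combination e3

lemma aux_top (c : ℂ) (hc : 0 < c.re) :
    Tendsto (fun x : ℝ => Complex.log (c + x * I) - Complex.log (c - x * I)) atTop
      (nhds (Real.pi * I)) := by
  have hz : Tendsto (fun x : ℝ => c * ((x⁻¹ : ℝ) : ℂ)) atTop (nhds 0) := by
    have : Tendsto (fun x : ℝ => ((x⁻¹ : ℝ) : ℂ)) atTop (nhds ((0 : ℝ) : ℂ)) :=
      (Complex.continuous_ofReal.tendsto 0).comp tendsto_inv_atTop_zero
    simpa using this.const_mul c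
  have h1 := (hz.add_const I).clog (by right; simp)
  have h2 := (hz.sub_const I).clog (by right; simp)
  have h := h1.sub h2
  have e : Complex.log (0 + I) - Complex.log (0 - I) = Real.pi * I := by
    simp [Complex.log_I, Complex.log_neg_I]; ring
  rw [e] at h
  refine h.congr' ?_
  filter_upwards [eventually_gt_atTop 0] with x hx
  have hx' : (x : ℂ) ≠ 0 := by exact_mod_cast hx.ne'
  have e1 : c + x * I = (x : ℂ) * (c * ((x⁻¹ : ℝ) : ℂ) + I) := by
    push_cast; field_simp
  have e2 : c - x * I = (x : ℂ) * (c * ((x⁻¹ : ℝ) : ℂ) - I) := by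
    push_cast; field_simp
  have n1 := aux_ne c hc x
  have n2 : c - x * I ≠ 0 := by
    have := aux_ne c hc (-x)
    simpa [sub_eq_add_neg] using this
  rw [e1] at n1 ⊢
  rw [e2] at n2 ⊢
  rw [Complex.log_ofReal_mul hx (right_ne_zero_of_mul n1),
    Complex.log_ofReal_mul hx (right_ne_zero_of_mul n2)]
  ring

lemma aux_bot (c : ℂ) (hc : 0 < c.re) :
    Tendsto (fun x : ℝ => Complex.log (c + x * I) - Complex.log (c - x * I)) atBot
      (nhds (-(Real.pi * I))) := by
  have h := ((aux_top c hc).comp tendsto_neg_atBot_atTop).neg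
  refine h.congr ?_
  intro x
  simp [sub_eq_add_neg]

lemma aux_integral (c : ℂ) (hc : 0 < c.re)
    (hi : Integrable (fun x : ℝ => ((x : ℂ) ^ 2 + c ^ 2)⁻¹)) :
    ∫ x : ℝ, ((x : ℂ) ^ 2 + c ^ 2)⁻¹ = Real.pi / c := by
  rw [integral_of_hasDerivAt_of_tendsto (aux_deriv c hc) hi
    ((aux_bot c hc).const_mul _) ((aux_top c hc).const_mul _)]
  have n0 : c ≠ 0 := by rintro rfl; simp at hc
  have := I_ne_zero
  field_simp
  ring

lemma aux_integrable (ω ε : ℝ) (hε : 0 < ε) :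
    Integrable (fun x : ℝ => ((x : ℂ) ^ 2 - (ω : ℂ) ^ 2 + (ε : ℂ) * I)⁻¹) := by
  have hn : ∀ x : ℝ, ε ≤ ‖(x : ℂ) ^ 2 - (ω : ℂ) ^ 2 + (ε : ℂ) * I‖ := by
    intro x
    have h := Complex.abs_im_le_norm ((x : ℂ) ^ 2 - (ω : ℂ) ^ 2 + (ε : ℂ) * I)
    have e : ((x : ℂ) ^ 2 - (ω : ℂ) ^ 2 + (ε : ℂ) * I).im = ε := by
      simp [← Complex.ofReal_pow]
    rw [e] at h
    exact (le_abs_self _).trans h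
  have hne : ∀ x : ℝ, (x : ℂ) ^ 2 - (ω : ℂ) ^ 2 + (ε : ℂ) * I ≠ 0 := fun x =>
    norm_pos_iff.1 (hε.trans_le (hn x))
  set K : ℝ := ‖1 + (ω : ℂ) ^ 2 - (ε : ℂ) * I‖ with hK
  refine (integrable_inv_one_add_sq.const_mul (1 + K / ε)).mono' ?_ ?_
  · exact (Continuous.inv₀ (by fun_prop) hne).aestronglyMeasurable
  · refine Eventually.of_forall fun x => ?_
    have h1 := hn x
    rw [norm_inv]
    have h2 : 1 + x ^ 2 ≤ ‖(x : ℂ) ^ 2 - (ω : ℂ) ^ 2 + (ε : ℂ) * I‖ + K := by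
      have := norm_add_le ((x : ℂ) ^ 2 - (ω : ℂ) ^ 2 + (ε : ℂ) * I)
        (1 + (ω : ℂ) ^ 2 - (ε : ℂ) * I)
      have e : (x : ℂ) ^ 2 - (ω : ℂ) ^ 2 + (ε : ℂ) * I + (1 + (ω : ℂ) ^ 2 - (ε : ℂ) * I)
        = ((1 + x ^ 2 : ℝ) : ℂ) := by push_cast; ring
      rw [e, Complex.norm_real] at this
      exact (le_abs_self _).trans this
    set N := ‖(x : ℂ) ^ 2 - (ω : ℂ) ^ 2 + (ε : ℂ) * I‖
    have hN : 0 < N := hε.trans_le h1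
    have hK0 : 0 ≤ K := norm_nonneg _
    have h3 : K ≤ K / ε * N := by
      rw [div_mul_eq_mul_div, le_div_iff₀ hε]
      gcongr
    have hp : 0 < 1 + x ^ 2 := by positivity
    rw [← div_eq_mul_inv, inv_le_iff_one_le_mul₀ hN, div_mul_eq_mul_div, le_div_iff₀ hp]
    linarith

/-- Feynman `iε` prescription on the whole line:
`lim_{ε→0⁺} ∫_ℝ dx/(x² − ω² + iε) = −iπ/ω`. -/
theorem feynman_ieps_full_line (ω : ℝ) (hω : 0 < ω) :
    Tendsto (fun ε : ℝ => ∫ x : ℝ, (((x : ℂ)) ^ 2 - ((ω : ℂ)) ^ 2 + (ε : ℂ) * I)⁻¹)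
      (nhdsWithin 0 (Set.Ioi 0))
      (nhds (-I * Real.pi / ω)) := by
  have hω' : (ω : ℂ) ≠ 0 := by exact_mod_cast hω.ne'
  let s : ℝ → ℂ := fun ε => ((ω : ℂ) ^ 2 - (ε : ℂ) * I) ^ (((2 : ℕ) : ℂ)⁻¹)
  have hs2 : ∀ ε, s ε ^ 2 = (ω : ℂ) ^ 2 - (ε : ℂ) * I := fun ε =>
    Complex.cpow_nat_inv_pow _ two_ne_zero
  have hs : Tendsto s (nhdsWithin 0 (Set.Ioi 0)) (nhds (ω : ℂ)) := by
    have hc : ContinuousAt s 0 := by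
      refine ContinuousAt.cpow (by fun_prop) continuousAt_const ?_
      left
      simp [← Complex.ofReal_pow]
      positivity
    have h0 : s 0 = ω := by
      simp only [s]
      have : (ω : ℂ) ^ 2 - ((0 : ℝ) : ℂ) * I = ((ω ^ 2 : ℝ) : ℂ) := by simp
      rw [this]
      have h2 : (((2 : ℕ) : ℂ)⁻¹) = (((2 : ℕ) : ℝ)⁻¹ : ℝ) := by simp
      rw [h2, ← Complex.ofReal_cpow (by positivity), Real.pow_rpow_inv_natCast hω.le two_ne_zero]
    have := hc.tendsto
    rw [h0] at this
    exact this.mono_left nhdsWithin_le_nhds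
  have hpos : ∀ᶠ ε in nhdsWithin (0 : ℝ) (Set.Ioi 0), 0 < (s ε).re :=
    ((Complex.continuous_re.tendsto _).comp hs).eventually_const_lt (by simpa using hω)
  have hlim : Tendsto (fun ε => (Real.pi : ℂ) / (I * s ε)) (nhdsWithin 0 (Set.Ioi 0))
      (nhds (-I * Real.pi / ω)) := by
    have e : -I * Real.pi / ω = (Real.pi : ℂ) / (I * ω) := by
      have := I_ne_zero
      field_simp
      simp
    rw [e]
    exact tendsto_const_nhds.div (hs.const_mul I) (mul_ne_zero I_ne_zero hω')
  refine hlim.congr' ?_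
  filter_upwards [hpos, self_mem_nhdsWithin] with ε hre hε
  have hε : 0 < ε := hε
  have him := congrArg Complex.im (hs2 ε)
  simp [pow_two] at him
  have hc : 0 < (I * s ε).re := by
    simp
    nlinarith
  have e : ∀ x : ℝ, (x : ℂ) ^ 2 - (ω : ℂ) ^ 2 + (ε : ℂ) * I = (x : ℂ) ^ 2 + (I * s ε) ^ 2 := by
    intro x
    rw [mul_pow, hs2, I_sq]; ring
  have hi := aux_integrable ω ε hε
  simp only [e] at hi ⊢
  exact (aux_integral _ hc hi).symm
end

section
/- Let ω > 0 and r₂ > ω. Then the limit as ε → 0⁺ of ∫_{−r₂}^{r₂} 1/(x² − ω² + iε) dx exists and equals −iπ/ω − (1/ω)·log((r₂ + ω)/(r₂ − ω)), where the integrand is the complex-valued function x ↦ (x² − ω² + iε)⁻¹. -/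
open MeasureTheory Filter Complex intervalIntegral

lemma feyn_aux_int (w : ℂ) (r : ℝ) (hw : w.im < 0) :
    ∫ x in (-r)..r, (((x : ℂ)) ^ 2 - w ^ 2)⁻¹ =
      (Complex.log (-I * (r - w)) - Complex.log (I * (r + w))
        - (Complex.log (-I * (-r - w)) - Complex.log (I * (-r + w)))) / (2 * w) := by
  have hw0 : w ≠ 0 := by
    rintro rfl
    simp at hw
  have h1 : ∀ x : ℝ, (x : ℂ) - w ≠ 0 := by
    intro x h
    have := congrArg Complex.im h
    simp at this
    linarith
  have h2 : ∀ x : ℝ, (x : ℂ) + w ≠ 0 := by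
    intro x h
    have := congrArg Complex.im h
    simp at this
    linarith
  have h3 : ∀ x : ℝ, (x : ℂ) ^ 2 - w ^ 2 ≠ 0 := by
    intro x
    have : (x : ℂ) ^ 2 - w ^ 2 = (x - w) * (x + w) := by ring
    rw [this]
    exact mul_ne_zero (h1 x) (h2 x)
  have hd : ∀ x : ℝ, HasDerivAt
      (fun x : ℝ => (Complex.log (-I * (x - w)) - Complex.log (I * (x + w))) / (2 * w))
      ((((x : ℂ)) ^ 2 - w ^ 2)⁻¹) x := by
    intro x
    have a1 : HasDerivAt (fun x : ℝ => -I * ((x : ℂ) - w)) (-I * 1) x :=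
      ((Complex.ofRealCLM.hasDerivAt (x := x)).sub_const w).const_mul (-I)
    have a2 : HasDerivAt (fun x : ℝ => I * ((x : ℂ) + w)) (I * 1) x :=
      ((Complex.ofRealCLM.hasDerivAt (x := x)).add_const w).const_mul I
    have b1 := a1.clog_real (by left; simpa using hw)
    have b2 := a2.clog_real (by left; simpa using hw)
    refine ((b1.sub b2).div_const (2 * w)).congr_deriv ?_
    have := h1 x
    have := h2 x
    have := h3 x
    have := I_ne_zero
    field_simp
    ring
  rw [integral_eq_sub_of_hasDerivAt (fun x _ => hd x)]
  · push_cast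
    ring
  · apply Continuous.intervalIntegrable
    exact Continuous.inv₀ (by fun_prop) h3

/-- Feynman `iε` prescription on the cutoff interval `[−r₂, r₂]` with `r₂ > ω`:
`lim_{ε→0⁺} ∫_{−r₂}^{r₂} dx/(x² − ω² + iε) = −iπ/ω − (1/ω)·log((r₂+ω)/(r₂−ω))`. -/
theorem feynman_ieps_cutoff_interval (ω r₂ : ℝ) (hω : 0 < ω) (hr : ω < r₂) :
    Tendsto
      (fun ε : ℝ =>
        ∫ x in (-r₂)..r₂, (((x : ℂ)) ^ 2 - ((ω : ℂ)) ^ 2 + (ε : ℂ) * I)⁻¹)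
      (nhdsWithin 0 (Set.Ioi 0))
      (nhds (-I * Real.pi / ω - (1 / (ω : ℂ)) * Real.log ((r₂ + ω) / (r₂ - ω)))) := by
  have hωc : (ω : ℂ) ≠ 0 := by exact_mod_cast hω.ne'
  set W : ℝ → ℂ := fun ε => Complex.exp (Complex.log ((ω : ℂ) ^ 2 - ε * I) / 2) with hW
  have hW0 : W 0 = ω := by
    have : (ω : ℂ) ^ 2 = ((ω ^ 2 : ℝ) : ℂ) := by push_cast; ring
    simp only [hW, Complex.ofReal_zero, zero_mul, sub_zero]
    rw [this, ← Complex.ofReal_log (by positivity), Real.log_pow]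
    push_cast
    rw [mul_div_cancel_left₀ _ two_ne_zero, ← Complex.ofReal_exp, Real.exp_log hω]
  have hWc : ContinuousAt W 0 := by
    have : ContinuousAt (fun ε : ℝ => Complex.log ((ω : ℂ) ^ 2 - ε * I)) 0 := by
      apply ContinuousAt.clog (by fun_prop)
      left
      simp [← Complex.ofReal_pow]
      positivity
    exact (this.div_const 2).cexp
  have hWt : Tendsto W (nhdsWithin 0 (Set.Ioi 0)) (nhds (ω : ℂ)) := by
    rw [← hW0]
    exact hWc.tendsto.mono_left nhdsWithin_le_nhds
  have hsq : ∀ ε : ℝ, W ε ^ 2 = (ω : ℂ) ^ 2 - ε * I := by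
    intro ε
    have hne : (ω : ℂ) ^ 2 - ε * I ≠ 0 := by
      intro h
      have := congrArg Complex.re h
      simp [← Complex.ofReal_pow] at this
      exact hω.ne' this
    simp only [hW]
    rw [← Complex.exp_nat_mul]
    push_cast
    rw [mul_div_cancel₀ _ two_ne_zero, Complex.exp_log hne]
  have hre : ∀ᶠ ε in nhdsWithin (0 : ℝ) (Set.Ioi 0), 0 < (W ε).re := by
    have := (Complex.continuous_re.tendsto (ω : ℂ)).comp hWt
    exact this.eventually (lt_mem_nhds (by simpa using hω))
  have key : ∀ᶠ ε in nhdsWithin (0 : ℝ) (Set.Ioi 0),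
      (Complex.log (-I * (r₂ - W ε)) - Complex.log (I * (r₂ + W ε))
        - (Complex.log (-I * (-r₂ - W ε)) - Complex.log (I * (-r₂ + W ε)))) / (2 * W ε)
      = ∫ x in (-r₂)..r₂, (((x : ℂ)) ^ 2 - ((ω : ℂ)) ^ 2 + (ε : ℂ) * I)⁻¹ := by
    filter_upwards [hre, self_mem_nhdsWithin] with ε h1 h2
    have h2 : 0 < ε := h2
    have him : (W ε).im < 0 := by
      have := congrArg Complex.im (hsq ε)
      simp [← Complex.ofReal_pow, pow_two] at this
      nlinarith
    rw [← feyn_aux_int (W ε) r₂ him]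
    congr 1
    ext x
    rw [hsq]
    congr 1
    ring
  refine Tendsto.congr' key ?_
  have hA : 0 < r₂ - ω := by linarith
  have hB : 0 < r₂ + ω := by linarith
  have c : ContinuousAt (fun w : ℂ =>
      (Complex.log (-I * (r₂ - w)) - Complex.log (I * (r₂ + w))
        - (Complex.log (-I * (-r₂ - w)) - Complex.log (I * (-r₂ + w)))) / (2 * w)) (ω : ℂ) := by
    refine ContinuousAt.div (((ContinuousAt.clog (by fun_prop) ?_).sub
      (ContinuousAt.clog (by fun_prop) ?_)).sub ((ContinuousAt.clog (by fun_prop) ?_).sub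
      (ContinuousAt.clog (by fun_prop) ?_))) (by fun_prop) (by simpa using hωc)
    all_goals
      right
      simp
      intro h
      linarith
  have := c.tendsto.comp hWt
  convert this using 2
  · rfl
  have e1 : Complex.log (-I * (r₂ - ω)) = Real.log (r₂ - ω) - Real.pi / 2 * I := by
    rw [mul_comm, ← Complex.ofReal_sub, Complex.log_ofReal_mul hA (by simp), Complex.log_neg_I]
    ring
  have e2 : Complex.log (I * (r₂ + ω)) = Real.log (r₂ + ω) + Real.pi / 2 * I := by
    rw [mul_comm, ← Complex.ofReal_add, Complex.log_ofReal_mul hB (by simp), Complex.log_I]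
  have e3 : -I * (-(r₂ : ℂ) - ω) = I * (r₂ + ω) := by ring
  have e4 : I * (-(r₂ : ℂ) + ω) = -I * (r₂ - ω) := by ring
  rw [e3, e4, e1, e2, Real.log_div hB.ne' hA.ne']
  push_cast
  field_simp
  ring
end

section
/- Let 0 ≤ r₁ < ω < r₂. Then the limit as ε → 0⁺ of [∫_{−r₂}^{−r₁} 1/(x² − ω² + iε) dx + ∫_{r₁}^{r₂} 1/(x² − ω² + iε) dx] exists and equals −iπ/ω − (1/ω)·( log((r₂ + ω)/(r₂ − ω)) − log((ω + r₁)/(ω − r₁)) ), where the integrand is the complex-valued function x ↦ (x² − ω² + iε)⁻¹. -/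
open MeasureTheory Filter Complex intervalIntegral

/-- Feynman `iε` prescription on the union of intervals `[−r₂,−r₁] ∪ [r₁,r₂]` with
`0 ≤ r₁ < ω < r₂`: the limit is
`−iπ/ω − (1/ω)(log((r₂+ω)/(r₂−ω)) − log((ω+r₁)/(ω−r₁)))`. -/
theorem feynman_ieps_two_intervals (ω r₁ r₂ : ℝ) (hr₁ : 0 ≤ r₁) (h₁ : r₁ < ω)
    (h₂ : ω < r₂) :
    Tendsto
      (fun ε : ℝ =>
        (∫ x in (-r₂)..(-r₁), (((x : ℂ)) ^ 2 - ((ω : ℂ)) ^ 2 + (ε : ℂ) * I)⁻¹)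
          + ∫ x in r₁..r₂, (((x : ℂ)) ^ 2 - ((ω : ℂ)) ^ 2 + (ε : ℂ) * I)⁻¹)
      (nhdsWithin 0 (Set.Ioi 0))
      (nhds (-I * Real.pi / ω -
        (1 / (ω : ℂ)) *
          ((Real.log ((r₂ + ω) / (r₂ - ω)) : ℂ) - (Real.log ((ω + r₁) / (ω - r₁)) : ℂ)))) := by
  have hω : 0 < ω := lt_of_le_of_lt hr₁ h₁
  have hω0 : (ω : ℂ) ≠ 0 := by exact_mod_cast hω.ne'
  set z : ℝ → ℂ := fun ε => ((ω : ℂ) ^ 2 - ε * I) ^ ((1 : ℂ) / 2) with hz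
  have hzsq : ∀ ε, z ε ^ 2 = (ω : ℂ) ^ 2 - ε * I := by
    intro ε
    simp only [hz]
    rw [one_div, show ((2 : ℂ)⁻¹) = ((2 : ℕ) : ℂ)⁻¹ by norm_num]
    exact Complex.cpow_nat_inv_pow _ (by norm_num)
  have hz0 : z 0 = ω := by
    simp only [hz, ofReal_zero, zero_mul, sub_zero]
    rw [one_div, show ((2 : ℂ)⁻¹) = ((2 : ℕ) : ℂ)⁻¹ by norm_num]
    apply Complex.pow_cpow_nat_inv (by norm_num)
    · rw [Complex.arg_ofReal_of_nonneg hω.le]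
      have := Real.pi_pos
      simp only [Left.neg_neg_iff, Nat.cast_ofNat]; positivity
    · rw [Complex.arg_ofReal_of_nonneg hω.le]
      positivity
  have hzt0 : Tendsto z (nhds 0) (nhds (ω : ℂ)) := by
    rw [← hz0]
    have : ContinuousAt z 0 := by
      apply ContinuousAt.cpow (by fun_prop) (by fun_prop)
      simp only [ofReal_zero, zero_mul, sub_zero]
      left
      rw [← ofReal_pow, ofReal_re]
      positivity
    exact this
  have hzt : Tendsto z (nhdsWithin 0 (Set.Ioi 0)) (nhds (ω : ℂ)) :=
    hzt0.mono_left nhdsWithin_le_nhds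
  have hre : ∀ᶠ ε in nhdsWithin (0:ℝ) (Set.Ioi 0), 0 < (z ε).re := by
    have h : Tendsto (fun ε => (z ε).re) (nhdsWithin 0 (Set.Ioi 0)) (nhds ω) := by
      have := (Complex.continuous_re.tendsto (ω : ℂ)).comp hzt
      simpa [Function.comp_def] using this
    exact h.eventually (lt_mem_nhds hω)
  have him : ∀ᶠ ε in nhdsWithin (0:ℝ) (Set.Ioi 0), (z ε).im < 0 := by
    filter_upwards [hre, self_mem_nhdsWithin] with ε h1 h2
    have h3 := congrArg Complex.im (hzsq ε)
    have h4 : (0:ℝ) < ε := h2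
    have h5 : 2 * ((z ε).re * (z ε).im) = -ε := by
      rw [pow_two, ← ofReal_pow] at h3
      simp only [mul_im, sub_im, ofReal_im, ofReal_re, I_re, I_im] at h3
      linarith
    by_contra h6
    push Not at h6
    nlinarith [mul_nonneg h1.le h6]
  have hneg : ∀ ε : ℝ, (∫ x in (-r₂)..(-r₁), (((x : ℂ)) ^ 2 - ((ω : ℂ)) ^ 2 + (ε : ℂ) * I)⁻¹)
      = ∫ x in r₁..r₂, (((x : ℂ)) ^ 2 - ((ω : ℂ)) ^ 2 + (ε : ℂ) * I)⁻¹ := by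
    intro ε
    rw [← intervalIntegral.integral_comp_neg
      (fun x : ℝ => (((x : ℂ)) ^ 2 - ((ω : ℂ)) ^ 2 + (ε : ℂ) * I)⁻¹)]
    simp
  have hmain : ∀ᶠ ε in nhdsWithin (0:ℝ) (Set.Ioi 0),
      (1 / z ε) * ((Complex.log (r₂ - z ε) - Complex.log (r₂ + z ε))
        - (Complex.log (r₁ - z ε) - Complex.log (r₁ + z ε))) =
      (∫ x in (-r₂)..(-r₁), (((x : ℂ)) ^ 2 - ((ω : ℂ)) ^ 2 + (ε : ℂ) * I)⁻¹)
          + ∫ x in r₁..r₂, (((x : ℂ)) ^ 2 - ((ω : ℂ)) ^ 2 + (ε : ℂ) * I)⁻¹ := by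
    filter_upwards [him] with ε hi
    have hzne : z ε ≠ 0 := by
      intro h; rw [h] at hi; simp at hi
    have hm : ∀ x : ℝ, (x : ℂ) - z ε ∈ slitPlane := by
      intro x
      right
      simp only [sub_im, ofReal_im, zero_sub]
      exact (neg_pos.mpr hi).ne'
    have hp : ∀ x : ℝ, (x : ℂ) + z ε ∈ slitPlane := by
      intro x
      right
      simp only [add_im, ofReal_im, zero_add]
      exact hi.ne
    have hfac : ∀ x : ℝ, ((x : ℂ)) ^ 2 - ((ω : ℂ)) ^ 2 + (ε : ℂ) * I
        = (x - z ε) * (x + z ε) := by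
      intro x
      linear_combination hzsq ε
    have hint : ∫ x in r₁..r₂, (((x : ℂ)) ^ 2 - ((ω : ℂ)) ^ 2 + (ε : ℂ) * I)⁻¹ =
        (1 / (2 * z ε)) * (Complex.log (r₂ - z ε) - Complex.log (r₂ + z ε))
        - (1 / (2 * z ε)) * (Complex.log (r₁ - z ε) - Complex.log (r₁ + z ε)) := by
      apply intervalIntegral.integral_eq_sub_of_hasDerivAt
        (f := fun x : ℝ => (1 / (2 * z ε)) * (Complex.log (x - z ε) - Complex.log (x + z ε)))
      · intro x _
        have d0 : HasDerivAt (fun x : ℝ => (x : ℂ)) 1 x := Complex.ofRealCLM.hasDerivAt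
        have d1 := (d0.sub_const (z ε)).clog_real (hm x)
        have d2 := (d0.add_const (z ε)).clog_real (hp x)
        have d3 := (d1.sub d2).const_mul (1 / (2 * z ε))
        refine HasDerivAt.congr_deriv d3 ?_
        rw [hfac]
        have e1 := slitPlane_ne_zero (hm x)
        have e2 := slitPlane_ne_zero (hp x)
        field_simp
        ring
      · apply Continuous.intervalIntegrable
        apply Continuous.inv₀ (by fun_prop)
        intro x
        rw [hfac]
        exact mul_ne_zero (slitPlane_ne_zero (hm x)) (slitPlane_ne_zero (hp x))
    rw [hneg, hint]
    field_simp
    ring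
  refine Tendsto.congr' hmain ?_
  have t1 : Tendsto (fun ε => Complex.log (r₂ - z ε)) (nhdsWithin 0 (Set.Ioi 0))
      (nhds (Complex.log (r₂ - ω))) := by
    apply (hzt.const_sub _).clog
    left; simpa using h₂
  have tp : ∀ r : ℝ, 0 ≤ r → Tendsto (fun ε => Complex.log (r + z ε))
      (nhdsWithin 0 (Set.Ioi 0)) (nhds (Complex.log (r + ω))) := by
    intro r hr
    apply (hzt.const_add _).clog
    left; simp; linarith
  have t3 : Tendsto (fun ε => Complex.log (r₁ - z ε)) (nhdsWithin 0 (Set.Ioi 0))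
      (nhds (Real.log (ω - r₁) + Real.pi * I)) := by
    have h := Complex.tendsto_log_nhdsWithin_im_nonneg_of_re_neg_of_im_zero
      (z := (r₁ : ℂ) - ω) (by simpa using h₁) (by simp)
    have hn : ‖(r₁ : ℂ) - ω‖ = ω - r₁ := by
      rw [← ofReal_sub, Complex.norm_real, Real.norm_eq_abs, abs_of_neg (by linarith)]; ring
    rw [hn] at h
    apply h.comp
    apply tendsto_nhdsWithin_of_tendsto_nhds_of_eventually_within _ (hzt.const_sub _)
    filter_upwards [him] with ε hi
    simp only [sub_im, ofReal_im, zero_sub]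
    linarith
  have tz : Tendsto (fun ε => 1 / z ε) (nhdsWithin 0 (Set.Ioi 0)) (nhds (1 / (ω : ℂ))) :=
    tendsto_const_nhds.div hzt hω0
  have tt := tz.mul ((t1.sub (tp r₂ (by linarith))).sub (t3.sub (tp r₁ hr₁)))
  convert tt using 2
  rw [Real.log_div (by linarith) (by linarith), Real.log_div (by linarith) (by linarith),
    ← ofReal_sub r₂ ω, ← ofReal_add r₂ ω, ← ofReal_add r₁ ω,
    ← Complex.ofReal_log (by linarith), ← Complex.ofReal_log (by linarith),
    ← Complex.ofReal_log (by linarith), add_comm r₁ ω]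
  push_cast
  ring
end
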